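/- arXiv:2411.14142 — 7 statements merged into one kernel-verified Lean document; each statement's English description precedes it below -/
import Mathlib

section
/- Let R be a commutative ring and S a multiplicative subset of R. Every s-flat R-module is S-flat; that is, if F is an R-module such that for every finitely presented R-module M there exists s ∈ S with s·Tor₁^R(M,F) = 0, then the localization F_S is a flat module over the localization R_S. -/
open CategoryTheory TensorProduct

universe u

variable {R : Type u} [CommRing R]

/-- `Tor₁^R(M, N)` as an object of `ModuleCat R`, via the derived tensor product. -/
noncomputable abbrev Tor1 (R : Type u) [CommRing R] (M N : Type u)
    [AddCommGroup M] [Module R M] [AddCommGroup N] [Module R N] : ModuleCat.{u} R :=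
  ((Tor (ModuleCat.{u} R) 1).obj (ModuleCat.of R M)).obj (ModuleCat.of R N)

/-- `Ext¹_R(M, N)` as an object of `ModuleCat R`. -/
noncomputable abbrev Ext1 (R : Type u) [CommRing R] (M N : Type u)
    [AddCommGroup M] [Module R M] [AddCommGroup N] [Module R N] : ModuleCat.{u} R :=
  ((Ext R (ModuleCat.{u} R) 1).obj (Opposite.op (ModuleCat.of R M))).obj (ModuleCat.of R N)

/-- u-S-exactness at the middle spot of `A →f B →g C`, with respect to a given `s`:
`s • ker g ⊆ im f` and `s • im f ⊆ ker g`. -/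
def IsUSExactAtWith (s : R) {A B C : Type u} [AddCommGroup A] [Module R A]
    [AddCommGroup B] [Module R B] [AddCommGroup C] [Module R C]
    (f : A →ₗ[R] B) (g : B →ₗ[R] C) : Prop :=
  (∀ x ∈ LinearMap.ker g, s • x ∈ LinearMap.range f) ∧
  (∀ x ∈ LinearMap.range f, s • x ∈ LinearMap.ker g)

/-- The sequence `0 → A →f B →g C → 0` is u-S-exact with respect to the single element `s`. -/
def ShortUSExactWith (s : R) {A B C : Type u} [AddCommGroup A] [Module R A]
    [AddCommGroup B] [Module R B] [AddCommGroup C] [Module R C]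
    (f : A →ₗ[R] B) (g : B →ₗ[R] C) : Prop :=
  (∀ x ∈ LinearMap.ker f, s • x = (0 : A)) ∧ IsUSExactAtWith s f g ∧
    (∀ c : C, s • c ∈ LinearMap.range g)

/-- The sequence `0 → A →f B →g C → 0` is u-S-exact (at every place, with possibly
different witnesses `s ∈ S`). -/
def ShortUSExact (S : Submonoid R) {A B C : Type u} [AddCommGroup A] [Module R A]
    [AddCommGroup B] [Module R B] [AddCommGroup C] [Module R C]
    (f : A →ₗ[R] B) (g : B →ₗ[R] C) : Prop :=
  (∃ s ∈ S, ∀ x ∈ LinearMap.ker f, s • x = (0 : A)) ∧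
  (∃ s ∈ S, IsUSExactAtWith s f g) ∧
  (∃ s ∈ S, ∀ c : C, s • c ∈ LinearMap.range g)

/-- A short exact sequence `0 → A →f B →g C → 0` is s-pure if tensoring it with every
finitely presented module yields a u-S-exact sequence. -/
def SPure (S : Submonoid R) {A B C : Type u} [AddCommGroup A] [Module R A]
    [AddCommGroup B] [Module R B] [AddCommGroup C] [Module R C]
    (f : A →ₗ[R] B) (g : B →ₗ[R] C) : Prop :=
  ∀ (M : Type u) [AddCommGroup M] [Module R M], Module.FinitePresentation R M →
    ShortUSExact S (LinearMap.lTensor M f) (LinearMap.lTensor M g)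

/-- A short exact sequence `0 → A →f B →g C → 0` is pure if tensoring it with every
finitely presented module yields an exact sequence `0 → M⊗A → M⊗B → M⊗C → 0`. -/
def IsPureSES {A B C : Type u} [AddCommGroup A] [Module R A]
    [AddCommGroup B] [Module R B] [AddCommGroup C] [Module R C]
    (f : A →ₗ[R] B) (g : B →ₗ[R] C) : Prop :=
  ∀ (M : Type u) [AddCommGroup M] [Module R M], Module.FinitePresentation R M →
    Function.Injective (LinearMap.lTensor M f) ∧
    Function.Exact (LinearMap.lTensor M f) (LinearMap.lTensor M g) ∧
    Function.Surjective (LinearMap.lTensor M g)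

/-- An `R`-module `F` is s-flat if for every finitely presented `M` there is `s ∈ S`
with `s • Tor₁(M, F) = 0`. -/
def IsSFlat (S : Submonoid R) (F : Type u) [AddCommGroup F] [Module R F] : Prop :=
  ∀ (M : Type u) [AddCommGroup M] [Module R M], Module.FinitePresentation R M →
    ∃ s ∈ S, ∀ x : Tor1 R M F, s • x = 0

/-- An `R`-module `E` is s-absolutely pure if for every finitely presented `N` there is
`s ∈ S` with `s • Ext¹(N, E) = 0`. -/
def IsSAbsolutelyPure (S : Submonoid R) (E : Type u) [AddCommGroup E] [Module R E] : Prop :=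
  ∀ (N : Type u) [AddCommGroup N] [Module R N], Module.FinitePresentation R N →
    ∃ s ∈ S, ∀ x : Ext1 R N E, s • x = 0

/-- An `R`-module `E` is absolutely pure if `Ext¹(N, E) = 0` for every finitely
presented `N`. -/
def IsAbsolutelyPure (R : Type u) [CommRing R] (E : Type u)
    [AddCommGroup E] [Module R E] : Prop :=
  ∀ (N : Type u) [AddCommGroup N] [Module R N], Module.FinitePresentation R N →
    ∀ x : Ext1 R N E, x = 0

/-- An injective cogenerator in the category of `R`-modules: an injective module `E`
such that `Hom_R(M, E) = 0` implies `M = 0`. -/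
def IsInjectiveCogenerator (R : Type u) [CommRing R] (E : Type u)
    [AddCommGroup E] [Module R E] : Prop :=
  Module.Injective R E ∧
    ∀ (M : Type u) [AddCommGroup M] [Module R M], (∀ φ : M →ₗ[R] E, φ = 0) → Subsingleton M

/-- An `R`-module `M` is `S`-finite if `s • M ⊆ K` for some `s ∈ S` and some finitely
generated submodule `K` of `M`. -/
def IsSFinite (S : Submonoid R) (M : Type u) [AddCommGroup M] [Module R M] : Prop :=
  ∃ s ∈ S, ∃ K : Submodule R M, K.FG ∧ ∀ m : M, s • m ∈ K

/-- An `R`-module `M` is `S`-finitely presented if there is an exact sequence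
`0 → K → F → M → 0` with `F` finitely generated free and `K` `S`-finite. -/
def IsSFinitelyPresented (S : Submonoid R) (M : Type u) [AddCommGroup M] [Module R M] : Prop :=
  ∃ (n : ℕ) (π : (Fin n → R) →ₗ[R] M), Function.Surjective π ∧
    IsSFinite S ↥(LinearMap.ker π)

/-- `R` is an `S`-coherent ring if every finitely generated ideal of `R` is
`S`-finitely presented. -/
def IsSCoherentRing (S : Submonoid R) : Prop :=
  ∀ I : Ideal R, I.FG → IsSFinitelyPresented S ↥I

/-- If `s` annihilates the homology of a short complex of modules, then `s` times any cycle
is a boundary. -/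
theorem shortComplex_exists_eq_smul_of_homology_smul_eq_zero {K : ShortComplex (ModuleCat.{u} R)}
    {s : R} (h : ∀ x : K.homology, s • x = 0) {x : K.X₂} (hx : K.g x = 0) :
    ∃ y : K.X₁, K.f y = s • x := by
  have h' : ∀ x : K.moduleCatLeftHomologyData.H, s • x = 0 := by
    intro x
    obtain ⟨y, rfl⟩ := K.moduleCatHomologyIso.toLinearEquiv.surjective x
    rw [← map_smul, h, map_zero]
  have := h' (Submodule.Quotient.mk ⟨x, hx⟩)
  erw [← Submodule.Quotient.mk_smul, Submodule.Quotient.mk_eq_zero] at this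
  obtain ⟨y, hy⟩ := this
  exact ⟨y, congrArg Subtype.val hy⟩

/-- If `s` annihilates `Tor₁(M, F)` and `P` is a projective resolution of `F`, then `s` times
any `1`-cycle of `M ⊗ P` is a boundary. -/
theorem exists_lTensor_d_eq_smul_of_tor1_smul_eq_zero {M F : Type u} [AddCommGroup M] [Module R M]
    [AddCommGroup F] [Module R F] (P : ProjectiveResolution (ModuleCat.of R F)) {s : R}
    (h : ∀ x : Tor1 R M F, s • x = 0) (x : M ⊗[R] (P.complex.X 1))
    (hx : (P.complex.d 1 0).hom.lTensor M x = 0) :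
    ∃ y, (P.complex.d 2 1).hom.lTensor M y = s • x := by
  let C := (((MonoidalCategory.tensoringLeft (ModuleCat.{u} R)).obj
    (.of R M)).mapHomologicalComplex (.down ℕ)).obj P.complex
  let e : Tor1 R M F ≅ (C.sc' 2 1 0).homology :=
    P.isoLeftDerivedObj _ 1 ≪≫ ShortComplex.homologyMapIso (C.isoSc' 2 1 0 (by simp) (by simp))
  have hC : ∀ x : (C.sc' 2 1 0).homology, s • x = 0 := by
    intro x
    obtain ⟨y, rfl⟩ := e.toLinearEquiv.surjective x
    rw [← map_smul, h, map_zero]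
  exact shortComplex_exists_eq_smul_of_homology_smul_eq_zero hC hx

theorem exists_sum_smul_of_mem_span_range_smul_top {ι Q : Type*} [Fintype ι] [AddCommGroup Q]
    [Module R Q] {a : ι → R} {x : Q}
    (hx : x ∈ Ideal.span (Set.range a) • (⊤ : Submodule R Q)) :
    ∃ w : ι → Q, x = ∑ i, a i • w i := by
  classical
  induction hx using Submodule.smul_induction_on' with
  | smul r hr n _ =>
    obtain ⟨c, rfl⟩ := (Ideal.mem_span_range_iff_exists_fun).1 hr
    exact ⟨fun i => c i • n, by simp only [Finset.sum_smul, mul_smul, smul_comm (a _)]⟩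
  | add x _ y _ hx hy =>
    obtain ⟨v, rfl⟩ := hx
    obtain ⟨w, rfl⟩ := hy
    exact ⟨v + w, by simp [Finset.sum_add_distrib]⟩

theorem quotient_one_tmul_eq_zero_iff {I : Ideal R} {Q : Type*} [AddCommGroup Q] [Module R Q]
    {x : Q} : (1 : R ⧸ I) ⊗ₜ[R] x = 0 ↔ x ∈ I • (⊤ : Submodule R Q) := by
  rw [← (TensorProduct.quotTensorEquivQuotSMul Q I).map_eq_zero_iff,
    TensorProduct.quotTensorEquivQuotSMul_mk_one_tmul, Submodule.Quotient.mk_eq_zero]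

/-- Every element of `(R ⧸ I) ⊗ Q` is of the form `1 ⊗ z`. -/
theorem quotient_exists_one_tmul_eq {I : Ideal R} {Q : Type*} [AddCommGroup Q] [Module R Q]
    (x : (R ⧸ I) ⊗[R] Q) : ∃ z : Q, 1 ⊗ₜ[R] z = x := by
  obtain ⟨z, hz⟩ := Submodule.Quotient.mk_surjective _ (TensorProduct.quotTensorEquivQuotSMul Q I x)
  refine ⟨z, (TensorProduct.quotTensorEquivQuotSMul Q I).injective ?_⟩
  rw [TensorProduct.quotTensorEquivQuotSMul_mk_one_tmul, hz]

/-- In an s-flat module, every linear relation becomes trivial after multiplication by an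
element of `S`. -/
theorem IsSFlat.exists_isTrivialRelation_smul {S : Submonoid R} {F : Type u} [AddCommGroup F]
    [Module R F] (hF : IsSFlat S F) {ι : Type*} [Fintype ι] {a : ι → R} {m : ι → F}
    (h : ∑ i, a i • m i = 0) : ∃ s ∈ S, Module.IsTrivialRelation a (fun i => s • m i) := by
  let I := Ideal.span (Set.range a)
  have hI : Module.FinitePresentation R (R ⧸ I) :=
    Module.finitePresentation_of_surjective I.mkQ I.mkQ_surjective
      (by rw [Submodule.ker_mkQ]; exact Submodule.fg_span (Set.finite_range a))
  obtain ⟨s, hs, hTor⟩ := hF (R ⧸ I) hI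
  refine ⟨s, hs, ?_⟩
  let P := projectiveResolution (ModuleCat.of R F)
  let d₁ : P.complex.X 1 →ₗ[R] P.complex.X 0 := (P.complex.d 1 0).hom
  let d₂ : P.complex.X 2 →ₗ[R] P.complex.X 1 := (P.complex.d 2 1).hom
  let ε : P.complex.X 0 →ₗ[R] F := (P.π.f 0).hom
  have hε : Function.Surjective ε := (ModuleCat.epi_iff_surjective (P.π.f 0)).1 inferInstance
  have hd : ∀ z, d₁ (d₂ z) = 0 := fun z =>
    LinearMap.congr_fun (congrArg ModuleCat.Hom.hom (P.complex.d_comp_d 2 1 0)) z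
  have hεd : ∀ z, ε (d₁ z) = 0 := fun z =>
    LinearMap.congr_fun (congrArg ModuleCat.Hom.hom P.complex_d_comp_π_f_zero) z
  choose p hp using fun i => hε (m i)
  have hpε : ε (∑ i, a i • p i) = 0 := by simpa [hp] using h
  obtain ⟨y, hy⟩ : ∃ y, d₁ y = ∑ i, a i • p i :=
    (ShortComplex.moduleCat_exact_iff _).1 P.exact₀ _ hpε
  have hcycle : d₁.lTensor (R ⧸ I) (1 ⊗ₜ y) = 0 := by
    rw [LinearMap.lTensor_tmul, hy, quotient_one_tmul_eq_zero_iff]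
    exact Submodule.sum_mem _ fun i _ =>
      Submodule.smul_mem_smul (Ideal.subset_span (Set.mem_range_self i)) trivial
  obtain ⟨z', hz'⟩ := exists_lTensor_d_eq_smul_of_tor1_smul_eq_zero P hTor _ hcycle
  obtain ⟨z, rfl⟩ := quotient_exists_one_tmul_eq z'
  change d₂.lTensor (R ⧸ I) (1 ⊗ₜ z) = _ at hz'
  rw [LinearMap.lTensor_tmul, ← TensorProduct.tmul_smul, eq_comm, ← sub_eq_zero,
    ← TensorProduct.tmul_sub, quotient_one_tmul_eq_zero_iff] at hz'
  obtain ⟨w, hw⟩ := exists_sum_smul_of_mem_span_range_smul_top hz'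
  have hrel : ∑ i, a i • (s • p i - d₁ (w i)) = 0 := by
    have := congrArg d₁ hw
    simp only [map_sub, map_smul, map_sum, hd, hy, sub_zero, Finset.smul_sum] at this
    simp only [smul_sub, Finset.sum_sub_distrib, ← this, smul_comm (a _) s, sub_self]
  have : Module.Projective R (P.complex.X 0) :=
    (IsProjective.iff_projective (P.complex.X 0)).2 (P.projective 0)
  obtain ⟨k, b, q, hq, hab⟩ := Module.Flat.isTrivialRelation_of_sum_smul_eq_zero hrel
  refine ⟨k, b, fun j => ε (q j), fun i => ?_, hab⟩
  simpa [hp, hεd] using congrArg ε (hq i)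

/-- Every s-flat module is S-flat: if `F` is s-flat then `F_S` is a flat `R_S`-module. -/
theorem isSFlat_implies_sFlat (R : Type u) [CommRing R] (S : Submonoid R)
    (F : Type u) [AddCommGroup F] [Module R F] (hF : IsSFlat S F) :
    Module.Flat (Localization S) (LocalizedModule S F) := by
  refine Module.Flat.of_forall_isTrivialRelation fun {l f x} h => ?_
  let φ := LocalizedModule.mkLinearMap S F
  obtain ⟨b, hb⟩ := IsLocalization.exist_integer_multiples_of_finite S f
  obtain ⟨c, hc⟩ := IsLocalizedModule.exist_integer_multiples_of_finite S φ x
  choose a ha using hb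
  choose m hm using hc
  have hφ : φ (∑ i, a i • m i) = 0 := by
    have hi : ∀ i, a i • φ (m i) = ((b : R) * c) • (f i • x i) := fun i => by
      rw [hm, ← algebraMap_smul (Localization S) (a i), ha, smul_assoc, smul_comm (f i) (c : R),
        mul_smul]
    simp only [map_sum, map_smul, hi, ← Finset.smul_sum, h, smul_zero]
  obtain ⟨t, ht⟩ := (IsLocalizedModule.eq_zero_iff S φ).1 hφ
  obtain ⟨s, hs, k, B, y, hy, hB⟩ :=
    hF.exists_isTrivialRelation_smul (a := fun i => (t : R) * a i) (m := m) (by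
      simpa only [mul_smul, ← Finset.smul_sum, Submonoid.smul_def] using ht)
  let r : S := ⟨s, hs⟩ * c
  refine ⟨k, fun i j => algebraMap R _ (B i j),
    fun j => Localization.mk 1 r • φ (y j), fun i => ?_, fun j => ?_⟩
  · have hr : Localization.mk 1 r • ((r : R) • x i) = x i := by
      rw [← algebraMap_smul (Localization S) (r : R), smul_smul, ← Localization.mk_one_eq_algebraMap,
        Localization.mk_mul, one_mul, mul_one, Localization.mk_self, one_smul]
    have hrx : (r : R) • x i = φ (s • m i) := by
      rw [map_smul, hm, ← mul_smul]
      rfl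
    rw [← hr, hrx, show s • m i = _ from hy i, map_sum, Finset.smul_sum]
    refine Finset.sum_congr rfl fun j _ => ?_
    rw [map_smul, algebraMap_smul, smul_comm]
  · have hu : IsUnit (algebraMap R (Localization S) (t * b)) :=
      IsLocalization.map_units (Localization S) (t * b)
    rw [← hu.mul_right_eq_zero, Finset.mul_sum, ← map_zero (algebraMap R (Localization S)), ← hB j,
      map_sum]
    refine Finset.sum_congr rfl fun i _ => ?_
    rw [map_mul, map_mul, map_mul, ha, Algebra.smul_def]
    ring
end

section
/- Let R be a commutative ring and S a multiplicative subset of R. If 0 → A → B → C → 0 is an s-pure short exact sequence of R-modules and B is s-flat, then C is s-flat; that is, any s-pure quotient module of an s-flat module is s-flat. -/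
open CategoryTheory TensorProduct

universe u

variable {R : Type u} [CommRing R]

/-- The kernel of `M ⊗ ker π → M ⊗ P` is annihilated by `s`. For a projective presentation
`π : P → X` this kernel is `Tor₁(M, X)`. -/
def KillsKerLTensor (s : R) (M : Type u) [AddCommGroup M] [Module R M] {P X : Type u}
    [AddCommGroup P] [Module R P] [AddCommGroup X] [Module R X] (π : P →ₗ[R] X) : Prop :=
  ∀ x : M ⊗[R] LinearMap.ker π, LinearMap.lTensor M (LinearMap.ker π).subtype x = 0 → s • x = 0

section Modules

variable {s t : R} {M P Q X : Type u} [AddCommGroup M] [Module R M]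
  [AddCommGroup P] [Module R P] [AddCommGroup Q] [Module R Q] [AddCommGroup X] [Module R X]

theorem KillsKerLTensor.of_projective [Module.Projective R P] [Module.Projective R Q]
    {π : P →ₗ[R] X} {ρ : Q →ₗ[R] X} (hπ : Function.Surjective π) (hρ : Function.Surjective ρ)
    (h : KillsKerLTensor s M ρ) : KillsKerLTensor s M π := by
  obtain ⟨a, ha⟩ := Module.projective_lifting_property ρ π hρ
  obtain ⟨b, hb⟩ := Module.projective_lifting_property π ρ hπ
  have ha' (p : P) : ρ (a p) = π p := LinearMap.congr_fun ha p
  have hb' (q : Q) : π (b q) = ρ q := LinearMap.congr_fun hb q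
  let a' : LinearMap.ker π →ₗ[R] LinearMap.ker ρ :=
    a.restrict fun p hp ↦ by simpa [ha'] using hp
  let b' : LinearMap.ker ρ →ₗ[R] LinearMap.ker π :=
    b.restrict fun q hq ↦ by simpa [hb'] using hq
  let k : P →ₗ[R] LinearMap.ker π :=
    (LinearMap.id - b ∘ₗ a).codRestrict _ fun p ↦ by simp [ha', hb']
  have hk : b' ∘ₗ a' + k ∘ₗ (LinearMap.ker π).subtype = LinearMap.id := by
    ext p
    simp [a', b', k]
  have ha'' : (LinearMap.ker ρ).subtype ∘ₗ a' = a ∘ₗ (LinearMap.ker π).subtype := rfl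
  intro x hx
  have hx' : LinearMap.lTensor M (LinearMap.ker ρ).subtype (LinearMap.lTensor M a' x) = 0 := by
    rw [← LinearMap.lTensor_comp_apply, ha'', LinearMap.lTensor_comp_apply, hx, map_zero]
  have hdecomp : LinearMap.lTensor M b' (LinearMap.lTensor M a' x) = x := by
    have := LinearMap.congr_fun (congrArg (LinearMap.lTensor M) hk) x
    simpa [LinearMap.lTensor_add, LinearMap.lTensor_comp_apply, hx] using this
  rw [← hdecomp, ← map_smul, h _ hx', map_zero]

theorem KillsKerLTensor.comp_of_exact {A B C : Type u} [AddCommGroup A] [Module R A]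
    [AddCommGroup B] [Module R B] [AddCommGroup C] [Module R C] {f : A →ₗ[R] B} {g : B →ₗ[R] C}
    (hf : Function.Injective f) (hfg : LinearMap.range f = LinearMap.ker g)
    {ρ : P →ₗ[R] B} (hρ : Function.Surjective ρ) (h : KillsKerLTensor s M ρ)
    (ht : ∀ x ∈ LinearMap.ker (LinearMap.lTensor M f), t • x = 0) :
    KillsKerLTensor (s * t) M (g ∘ₗ ρ) := by
  let i : LinearMap.ker ρ →ₗ[R] LinearMap.ker (g ∘ₗ ρ) :=
    Submodule.inclusion (LinearMap.ker_le_ker_comp ρ g)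
  let q : LinearMap.ker (g ∘ₗ ρ) →ₗ[R] A :=
    (LinearEquiv.ofInjective f hf).symm.toLinearMap ∘ₗ
      ρ.restrict (q := LinearMap.range f) fun p hp ↦ by rw [hfg]; exact hp
  have hfq (x : LinearMap.ker (g ∘ₗ ρ)) : f (q x) = ρ x :=
    congrArg Subtype.val ((LinearEquiv.ofInjective f hf).apply_symm_apply _)
  have hq : Function.Surjective q := fun a ↦ by
    obtain ⟨p, hp⟩ := hρ (f a)
    have hga : f a ∈ LinearMap.ker g := hfg ▸ LinearMap.mem_range_self f a
    exact ⟨⟨p, by simpa [hp] using hga⟩, hf (by rw [hfq, hp])⟩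
  have hiq : Function.Exact i q := fun x ↦ by
    rw [← hf.eq_iff, hfq, map_zero]
    exact ⟨fun hx ↦ ⟨⟨x, hx⟩, rfl⟩, by rintro ⟨y, rfl⟩; exact y.2⟩
  have hfq' : f ∘ₗ q = ρ ∘ₗ (LinearMap.ker (g ∘ₗ ρ)).subtype := LinearMap.ext hfq
  have hi : (LinearMap.ker (g ∘ₗ ρ)).subtype ∘ₗ i = (LinearMap.ker ρ).subtype := rfl
  intro x hx
  have hqx : LinearMap.lTensor M q (t • x) = 0 := by
    rw [map_smul]
    refine ht _ ?_
    rw [LinearMap.mem_ker, ← LinearMap.lTensor_comp_apply, hfq', LinearMap.lTensor_comp_apply, hx,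
      map_zero]
  obtain ⟨y, hy⟩ := (lTensor_exact M hiq hq _).1 hqx
  have hy0 : LinearMap.lTensor M (LinearMap.ker ρ).subtype y = 0 := by
    rw [← hi, LinearMap.lTensor_comp_apply, hy, map_smul, hx, smul_zero]
  rw [mul_smul, ← hy, ← map_smul, h y hy0, map_zero]

theorem killsKerLTensor_iff_of_exact {P₂ P₁ : Type u} [AddCommGroup P₂] [Module R P₂]
    [AddCommGroup P₁] [Module R P₁] {d₂ : P₂ →ₗ[R] P₁} {d₁ : P₁ →ₗ[R] P} {π : P →ₗ[R] X}
    (h₂ : Function.Exact d₂ d₁) (h₁ : Function.Exact d₁ π) :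
    KillsKerLTensor s M π ↔ ∀ x : M ⊗[R] P₁, LinearMap.lTensor M d₁ x = 0 →
      s • x ∈ LinearMap.range (LinearMap.lTensor M d₂) := by
  let e : P₁ →ₗ[R] LinearMap.ker π := d₁.codRestrict _ h₁.apply_apply_eq_zero
  have he : Function.Surjective e := fun ⟨p, hp⟩ ↦ by
    obtain ⟨y, rfl⟩ := (h₁ p).1 hp
    exact ⟨y, rfl⟩
  have hde : Function.Exact d₂ e := fun x ↦ by
    rw [← h₂ x, Subtype.ext_iff]
    rfl
  have hd₁ : (LinearMap.ker π).subtype ∘ₗ e = d₁ := rfl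
  have hex := lTensor_exact M hde he
  refine ⟨fun h x hx ↦ (hex _).1 ?_, fun h x hx ↦ ?_⟩
  · rw [map_smul]
    refine h _ ?_
    rwa [← LinearMap.lTensor_comp_apply, hd₁]
  · obtain ⟨y, rfl⟩ := LinearMap.lTensor_surjective M he x
    rw [← map_smul]
    refine (hex _).2 (h y ?_)
    rwa [← hd₁, LinearMap.lTensor_comp_apply]

end Modules

theorem ModuleCat.forall_smul_eq_zero_iff_of_iso {X Y : ModuleCat.{u} R} (e : X ≅ Y) (s : R) :
    (∀ x : X, s • x = 0) ↔ ∀ y : Y, s • y = 0 := by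
  rw [e.toLinearEquiv.toEquiv.forall_congr_left]
  exact forall_congr' fun y ↦ by
    rw [← e.toLinearEquiv.symm.map_eq_zero_iff (x := s • y), map_smul]
    rfl

theorem CategoryTheory.ShortComplex.moduleCat_forall_smul_homology_eq_zero_iff
    (T : ShortComplex (ModuleCat.{u} R)) (s : R) :
    (∀ x : T.homology, s • x = 0) ↔
      ∀ x : T.X₂, T.g.hom x = 0 → s • x ∈ LinearMap.range T.f.hom := by
  rw [ModuleCat.forall_smul_eq_zero_iff_of_iso T.moduleCatHomologyIso]
  refine (Submodule.Quotient.mk_surjective _).forall.trans <| Subtype.forall.trans <|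
    forall₂_congr fun x hx ↦ ?_
  exact (Submodule.Quotient.mk_eq_zero _ (x := s • (⟨x, hx⟩ : LinearMap.ker T.g.hom))).trans
    (exists_congr fun y ↦ Subtype.ext_iff)

theorem tor1_smul_eq_zero_iff (s : R) (M : Type u) [AddCommGroup M] [Module R M] {P X : Type u}
    [AddCommGroup P] [Module R P] [AddCommGroup X] [Module R X] [Module.Projective R P]
    {π : P →ₗ[R] X} (hπ : Function.Surjective π) :
    (∀ x : Tor1 R M X, s • x = 0) ↔ KillsKerLTensor s M π := by
  let Q := projectiveResolution (ModuleCat.of R X)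
  let F := (MonoidalCategory.tensoringLeft (ModuleCat.{u} R)).obj (ModuleCat.of R M)
  let K := (F.mapHomologicalComplex (ComplexShape.down ℕ)).obj Q.complex
  let π' : Q.complex.X 0 →ₗ[R] X := (Q.π.f 0).hom
  have hπ' : Function.Surjective π' := (ModuleCat.epi_iff_surjective (Q.π.f 0)).1 inferInstance
  have h₂ : Function.Exact (Q.complex.d 2 1).hom (Q.complex.d 1 0).hom :=
    (ShortComplex.ShortExact.moduleCat_exact_iff_function_exact _).1 (Q.exact_succ 0)
  have h₁ : Function.Exact (Q.complex.d 1 0).hom π' :=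
    (ShortComplex.ShortExact.moduleCat_exact_iff_function_exact _).1
      (ShortComplex.exact_of_g_is_cokernel (.mk _ _ Q.complex_d_comp_π_f_zero)
        Q.isColimitCokernelCofork)
  have : Module.Projective R (Q.complex.X 0) :=
    (IsProjective.iff_projective _).2 (Q.projective 0)
  have e : Tor1 R M X ≅ (K.sc' 2 1 0).homology :=
    Q.isoLeftDerivedObj F 1 ≪≫ ShortComplex.homologyMapIso (K.isoSc' 2 1 0 (by simp) (by simp))
  rw [ModuleCat.forall_smul_eq_zero_iff_of_iso e,
    ShortComplex.moduleCat_forall_smul_homology_eq_zero_iff]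
  exact (killsKerLTensor_iff_of_exact h₂ h₁).symm.trans
    ⟨fun h ↦ h.of_projective hπ hπ', fun h ↦ h.of_projective hπ' hπ⟩

/-- Lemma 2.5: any s-pure quotient module of an s-flat module is s-flat. -/
theorem isSFlat_of_sPure_quotient (R : Type u) [CommRing R] (S : Submonoid R)
    (A B C : Type u) [AddCommGroup A] [Module R A] [AddCommGroup B] [Module R B]
    [AddCommGroup C] [Module R C] (f : A →ₗ[R] B) (g : B →ₗ[R] C)
    (hf : Function.Injective f) (hfg : LinearMap.range f = LinearMap.ker g)
    (hg : Function.Surjective g) (hpure : SPure S f g) (hB : IsSFlat S B) :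
    IsSFlat S C := by
  intro M _ _ hM
  obtain ⟨s, hs, hsB⟩ := hB M hM
  obtain ⟨⟨t, ht, htA⟩, -, -⟩ := hpure M hM
  have hρ : Function.Surjective (Finsupp.linearCombination R (id : B → B)) :=
    Finsupp.linearCombination_id_surjective R B
  refine ⟨s * t, S.mul_mem hs ht, (tor1_smul_eq_zero_iff (s * t) M
    (π := g ∘ₗ Finsupp.linearCombination R (id : B → B)) (hg.comp hρ)).2 ?_⟩
  exact ((tor1_smul_eq_zero_iff s M hρ).1 hsB).comp_of_exact hf hfg hρ htA
end

section
/- Let R be a commutative ring and S a multiplicative subset of R. An R-module F is s-flat if and only if every short exact sequence of R-modules of the form 0 → A → B → F → 0 is s-pure. -/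
open CategoryTheory TensorProduct

universe u

variable {R : Type u} [CommRing R]

section

open LinearMap

theorem smul_moduleCat_homology_eq_zero_iff (T : ShortComplex (ModuleCat.{u} R)) (s : R) :
    (∀ x : T.homology, s • x = 0) ↔ ∀ z ∈ ker T.g.hom, s • z ∈ range T.f.hom := by
  have key : (∀ x : T.homology, s • x = 0) ↔
      ∀ x : ker T.g.hom ⧸ range T.moduleCatToCycles, s • x = 0 := by
    let e : T.homology ≃ₗ[R] (ker T.g.hom ⧸ range T.moduleCatToCycles) :=
      T.moduleCatHomologyIso.toLinearEquiv
    refine ⟨fun h x => ?_, fun h x => ?_⟩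
    · rw [← e.apply_symm_apply x, ← map_smul, h, map_zero]
    · rw [← e.symm_apply_apply x, ← map_smul, h, map_zero]
  rw [key]
  refine ⟨fun h z hz => ?_, fun h x => ?_⟩
  · have := h (Submodule.Quotient.mk ⟨z, hz⟩)
    rw [← Submodule.Quotient.mk_smul, Submodule.Quotient.mk_eq_zero] at this
    obtain ⟨y, hy⟩ := this
    exact ⟨y, congrArg Subtype.val hy⟩
  · obtain ⟨⟨z, hz⟩, rfl⟩ := Submodule.Quotient.mk_surjective _ x
    obtain ⟨y, hy⟩ := h z hz
    rw [← Submodule.Quotient.mk_smul, Submodule.Quotient.mk_eq_zero]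
    exact ⟨y, Subtype.ext hy⟩

theorem smul_Tor1_eq_zero_iff_of_projectiveResolution (M F : Type u)
    [AddCommGroup M] [Module R M] [AddCommGroup F] [Module R F]
    (P : ProjectiveResolution (ModuleCat.of R F)) (s : R) :
    (∀ x : Tor1 R M F, s • x = 0) ↔
      ∀ z ∈ ker (lTensor M (P.complex.d 1 0).hom),
        s • z ∈ range (lTensor M (P.complex.d 2 1).hom) := by
  let T := (((MonoidalCategory.tensoringLeft (ModuleCat.{u} R)).obj
    (ModuleCat.of R M)).mapHomologicalComplex (ComplexShape.down ℕ)).obj P.complex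
  let e : Tor1 R M F ≃ₗ[R] (T.sc' 2 1 0).homology :=
    (P.isoLeftDerivedObj ((MonoidalCategory.tensoringLeft (ModuleCat.{u} R)).obj
      (ModuleCat.of R M)) 1 ≪≫ T.homologyIsoSc' 2 1 0 (by simp) (by simp)).toLinearEquiv
  refine Iff.trans ⟨fun h x => ?_, fun h x => ?_⟩
    (smul_moduleCat_homology_eq_zero_iff (T.sc' 2 1 0) s)
  · rw [← e.apply_symm_apply x, ← map_smul, h, map_zero]
  · rw [← e.symm_apply_apply x, ← map_smul, h, map_zero]

theorem smul_ker_lTensor_range_subtype_eq_zero_iff (M : Type u) {P₂ P₁ P₀ : Type u}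
    [AddCommGroup M] [Module R M] [AddCommGroup P₂] [Module R P₂] [AddCommGroup P₁] [Module R P₁]
    [AddCommGroup P₀] [Module R P₀] (d₂ : P₂ →ₗ[R] P₁) (d₁ : P₁ →ₗ[R] P₀)
    (hd : Function.Exact d₂ d₁) (s : R) :
    (∀ z ∈ ker (lTensor M d₁), s • z ∈ range (lTensor M d₂)) ↔
      ∀ y ∈ ker (lTensor M (range d₁).subtype), s • y = 0 := by
  have hex : Function.Exact d₂ d₁.rangeRestrict := fun x => by
    rw [← hd x, ← Subtype.val_inj]; rfl
  have hT := lTensor_exact M hex d₁.surjective_rangeRestrict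
  have hcomp (z : M ⊗[R] P₁) :
      lTensor M (range d₁).subtype (lTensor M d₁.rangeRestrict z) = lTensor M d₁ z := by
    rw [← lTensor_comp_apply]; rfl
  refine ⟨fun h y hy => ?_, fun h z hz => ?_⟩
  · obtain ⟨z, rfl⟩ := lTensor_surjective M d₁.surjective_rangeRestrict y
    rw [← map_smul]
    exact (hT _).2 (h z (by rwa [mem_ker, hcomp] at hy))
  · refine (hT _).1 ?_
    rw [map_smul]
    exact h _ (by rwa [mem_ker, hcomp])

theorem smul_Tor1_eq_zero_iff (M F : Type u)
    [AddCommGroup M] [Module R M] [AddCommGroup F] [Module R F]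
    (P : ProjectiveResolution (ModuleCat.of R F)) (s : R) :
    (∀ x : Tor1 R M F, s • x = 0) ↔
      ∀ y ∈ ker (lTensor M (range (P.complex.d 1 0).hom).subtype), s • y = 0 :=
  (smul_Tor1_eq_zero_iff_of_projectiveResolution M F P s).trans
    (smul_ker_lTensor_range_subtype_eq_zero_iff M _ _
      (fun x => (SetLike.ext_iff.1 (P.exact_succ 0).moduleCat_range_eq_ker x).symm) s)

/-- Let `0 → K → P → F → 0` and `0 → A → B → F → 0` be exact with `P` projective. If `s` kills
`ker (M ⊗ K → M ⊗ P)`, then it kills `ker (M ⊗ A → M ⊗ B)`. -/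
theorem smul_ker_lTensor_eq_zero_of_projective (M : Type u) {K P A B F : Type u}
    [AddCommGroup M] [Module R M] [AddCommGroup K] [Module R K] [AddCommGroup P] [Module R P]
    [AddCommGroup A] [Module R A] [AddCommGroup B] [Module R B] [AddCommGroup F] [Module R F]
    [Module.Projective R P] {i : K →ₗ[R] P} {p : P →ₗ[R] F} (hip : Function.Exact i p)
    (hp : Function.Surjective p) {f : A →ₗ[R] B} {g : B →ₗ[R] F} (hf : Function.Injective f)
    (hfg : Function.Exact f g) (hg : Function.Surjective g) {s : R}
    (hs : ∀ y ∈ ker (lTensor M i), s • y = 0) :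
    ∀ x ∈ ker (lTensor M f), s • x = 0 := by
  obtain ⟨l, hl⟩ := Module.projective_lifting_property g p hg
  have hl' (q : P) : g (l q) = p q := LinearMap.congr_fun hl q
  let ef : A ≃ₗ[R] range f := LinearEquiv.ofInjective f hf
  have hk (k : K) : l (i k) ∈ range f := (hfg _).1 (by rw [hl', hip.apply_apply_eq_zero])
  let h : K →ₗ[R] A := ef.symm.toLinearMap ∘ₗ (l ∘ₗ i).codRestrict (range f) hk
  have hh (k : K) : f (h k) = l (i k) :=
    congrArg Subtype.val (ef.apply_symm_apply ⟨l (i k), hk k⟩)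
  let j : K →ₗ[R] A × P := h.prod (-i)
  let q : A × P →ₗ[R] B := f.coprod l
  have hq : Function.Surjective q := fun b => by
    obtain ⟨t, ht⟩ := hp (g b)
    obtain ⟨a, ha⟩ := (hfg (b - l t)).1 (by rw [map_sub, hl', ht, sub_self])
    exact ⟨(a, t), by simp [q, ha]⟩
  have hjq : Function.Exact j q := by
    rintro ⟨a, t⟩
    constructor
    · intro hat
      have hat' : f a + l t = 0 := by simpa [q] using hat
      have ht : p t = 0 := by
        have := congrArg g hat'
        rwa [map_add, hfg.apply_apply_eq_zero, zero_add, hl', map_zero] at this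
      obtain ⟨k, rfl⟩ := (hip t).1 ht
      refine ⟨-k, Prod.ext (hf ?_) ?_⟩
      · simpa [j, hh] using (eq_neg_of_add_eq_zero_left hat').symm
      · simp [j]
    · rintro ⟨k, hk⟩
      rw [← hk]
      simp [j, q, hh]
  intro x hx
  have hx' : lTensor M q (lTensor M (inl R A P) x) = 0 := by
    rw [← lTensor_comp_apply, coprod_inl]
    exact hx
  obtain ⟨y, hy⟩ := (lTensor_exact M hjq hq _).1 hx'
  have hy₁ : lTensor M h y = x := by
    have := congrArg (lTensor M (fst R A P)) hy
    rwa [← lTensor_comp_apply, ← lTensor_comp_apply, fst_prod, fst_comp_inl,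
      lTensor_id, LinearMap.id_apply] at this
  have hy₂ : lTensor M i y = 0 := by
    have := congrArg (lTensor M (snd R A P)) hy
    rwa [← lTensor_comp_apply, ← lTensor_comp_apply, snd_prod, snd_comp_inl,
      lTensor_zero, LinearMap.zero_apply, lTensor_neg, LinearMap.neg_apply, neg_eq_zero] at this
  rw [← hy₁, ← map_smul, hs y hy₂, map_zero]

end

/-- Proposition 2.6: `F` is s-flat iff every short exact sequence `0 → A → B → F → 0`
is s-pure. -/
theorem isSFlat_iff_ses_sPure (R : Type u) [CommRing R] (S : Submonoid R)
    (F : Type u) [AddCommGroup F] [Module R F] :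
    IsSFlat S F ↔
      ∀ (A B : Type u) [AddCommGroup A] [Module R A] [AddCommGroup B] [Module R B]
        (f : A →ₗ[R] B) (g : B →ₗ[R] F),
        Function.Injective f → LinearMap.range f = LinearMap.ker g →
          Function.Surjective g → SPure S f g := by
  obtain ⟨P⟩ : Nonempty (ProjectiveResolution (ModuleCat.of R F)) :=
    (inferInstance : HasProjectiveResolution (ModuleCat.of R F)).out
  have hexact : Function.Exact (P.complex.d 1 0).hom (P.π.f 0).hom :=
    fun x => (SetLike.ext_iff.1 P.exact₀.moduleCat_range_eq_ker x).symm
  have hsurj : Function.Surjective (P.π.f 0).hom :=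
    (ModuleCat.epi_iff_surjective (P.π.f 0)).1 inferInstance
  have hrange : Function.Exact (LinearMap.range (P.complex.d 1 0).hom).subtype (P.π.f 0).hom :=
    fun x => (hexact x).trans (by simp)
  constructor
  · intro hF A B _ _ _ _ f g hf hfg hg M _ _ hM
    have hfg' : Function.Exact f g := LinearMap.exact_iff.2 hfg.symm
    have hT := lTensor_exact M hfg' hg
    obtain ⟨s, hs, hsF⟩ := hF M hM
    have : Module.Projective R (P.complex.X 0) :=
      (IsProjective.iff_projective (P.complex.X 0)).2 (P.projective 0)
    refine ⟨⟨s, hs, ?_⟩, ⟨1, S.one_mem, ?_, ?_⟩, 1, S.one_mem, ?_⟩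
    · exact smul_ker_lTensor_eq_zero_of_projective (p := (P.π.f 0).hom) M hrange hsurj hf hfg' hg
        ((smul_Tor1_eq_zero_iff M F P s).1 hsF)
    · intro x hx
      rw [one_smul]
      exact (hT x).1 hx
    · intro x hx
      rw [one_smul]
      exact (hT x).2 hx
    · intro c
      rw [one_smul]
      exact LinearMap.lTensor_surjective M hg c
  · intro h M _ _ hM
    obtain ⟨⟨s, hs, hsM⟩, -⟩ := h _ _ (LinearMap.range (P.complex.d 1 0).hom).subtype
      (P.π.f 0).hom (Submodule.injective_subtype _) (LinearMap.exact_iff.1 hrange).symm hsurj M hM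
    exact ⟨s, hs, (smul_Tor1_eq_zero_iff M F P s).2 hsM⟩
end

section
/- Let R be a commutative ring, S a multiplicative subset of R, E an injective cogenerator in the category of R-modules, s ∈ S, and T an R-module. Then s·T = 0 if and only if s·Hom_R(T,E) = 0; that is, T is uniformly S-torsion with respect to s if and only if Hom_R(T,E) is uniformly S-torsion with respect to s. -/
open CategoryTheory TensorProduct

universe u

variable {R : Type u} [CommRing R]

/-- Over an injective cogenerator `E`, a linear map `f : M → N` whose composite with
every linear map `N → E` vanishes is zero. -/
theorem IsInjectiveCogenerator.eq_zero_of_comp_eq_zero {R : Type u} [CommRing R] {E : Type u}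
    [AddCommGroup E] [Module R E] (hE : IsInjectiveCogenerator R E) {M N : Type u}
    [AddCommGroup M] [Module R M] [AddCommGroup N] [Module R N] (f : M →ₗ[R] N)
    (h : ∀ φ : N →ₗ[R] E, φ ∘ₗ f = 0) : f = 0 := by
  have : Subsingleton (LinearMap.range f) := by
    refine hE.2 _ fun φ => ?_
    obtain ⟨ψ, hψ⟩ := hE.1.out (LinearMap.range f).subtype Subtype.val_injective φ
    ext ⟨_, x, rfl⟩
    exact (hψ _).symm.trans (LinearMap.congr_fun (h ψ) x)
  rw [← LinearMap.range_eq_bot]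
  exact Submodule.eq_bot_of_subsingleton

/-- Lemma 3.3: for an injective cogenerator `E`, a module `T` is uniformly S-torsion
with respect to `s` iff `Hom_R(T, E)` is. -/
theorem uSTorsion_iff_hom_uSTorsion (R : Type u) [CommRing R] (S : Submonoid R)
    (E : Type u) [AddCommGroup E] [Module R E] (hE : IsInjectiveCogenerator R E)
    (s : R) (hs : s ∈ S) (T : Type u) [AddCommGroup T] [Module R T] :
    (∀ t : T, s • t = 0) ↔ (∀ φ : T →ₗ[R] E, s • φ = 0) := by
  refine ⟨fun h φ => ?_, fun h t => ?_⟩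
  · ext t
    rw [LinearMap.smul_apply, ← map_smul, h, map_zero, LinearMap.zero_apply]
  · refine LinearMap.congr_fun
      (hE.eq_zero_of_comp_eq_zero (LinearMap.lsmul R T s) fun φ => ?_) t
    ext x
    simpa using LinearMap.congr_fun (h φ) x
end

section
/- Let R be a commutative ring, S a multiplicative subset of R, and F an R-module. The following are equivalent: (1) F is s-flat; (2) Hom_R(F,E) is s-absolutely pure for every injective R-module E; (3) for every injective cogenerator E in the category of R-modules, Hom_R(F,E) is s-absolutely pure. -/
open CategoryTheory TensorProduct

universe u

variable {R : Type u} [CommRing R]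

lemma LinearMap.lTensor_rTensor_comm_apply {R : Type*} [CommRing R] {A B C D : Type*}
    [AddCommGroup A] [Module R A] [AddCommGroup B] [Module R B] [AddCommGroup C] [Module R C]
    [AddCommGroup D] [Module R D] (f : A →ₗ[R] B) (g : C →ₗ[R] D) (x : A ⊗[R] C) :
    g.lTensor B (f.rTensor C x) = f.rTensor D (g.lTensor A x) := by
  rw [← LinearMap.comp_apply, ← LinearMap.comp_apply, LinearMap.lTensor_comp_rTensor,
    LinearMap.rTensor_comp_lTensor]
/-- An element `s` annihilates the homology of a complex of modules iff `s` sends every cycle to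
a boundary. -/
lemma CategoryTheory.ShortComplex.moduleCat_smul_homology_eq_zero_iff {R : Type u} [CommRing R]
    (T : ShortComplex (ModuleCat.{u} R)) (s : R) :
    (∀ x : T.homology, s • x = 0) ↔ ∀ x : T.X₂, T.g x = 0 → ∃ y : T.X₁, T.f y = s • x := by
  let e : T.homology ≃ₗ[R] (LinearMap.ker T.g.hom ⧸ LinearMap.range T.moduleCatToCycles) :=
    T.moduleCatHomologyIso.toLinearEquiv
  have key (x : LinearMap.ker T.g.hom) :
      s • (LinearMap.range T.moduleCatToCycles).mkQ x = 0 ↔ ∃ y, T.f y = s • x.1 := by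
    rw [← map_smul, Submodule.mkQ_apply, Submodule.Quotient.mk_eq_zero, LinearMap.mem_range]
    exact exists_congr fun y => Subtype.ext_iff
  constructor
  · intro h x hx
    refine (key ⟨x, hx⟩).1 (e.symm.injective ?_)
    rw [map_smul, h, map_zero]
  · intro h x
    obtain ⟨y, hy⟩ := Submodule.mkQ_surjective _ (e x)
    apply e.injective
    rw [map_smul, map_zero, ← hy]
    exact (key y).2 (h y.1 y.2)

lemma CategoryTheory.Iso.forall_smul_eq_zero_iff {R : Type u} [CommRing R]
    {A B : ModuleCat.{u} R} (e : A ≅ B) (s : R) :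
    (∀ x : A, s • x = 0) ↔ ∀ x : B, s • x = 0 := by
  have (x : A) : s • e.toLinearEquiv x = 0 ↔ s • x = 0 := by
    rw [← map_smul, LinearEquiv.map_eq_zero_iff]
  rw [e.toLinearEquiv.surjective.forall]
  exact forall_congr' fun x => (this x).symm

lemma tor1_smul_eq_zero_iff_of_projectiveResolution {R : Type u} [CommRing R] (M F : Type u)
    [AddCommGroup M] [Module R M] [AddCommGroup F] [Module R F] (s : R)
    (P : ProjectiveResolution (ModuleCat.of R F)) :
    (∀ x : Tor1 R M F, s • x = 0) ↔
      ∀ x : M ⊗[R] P.complex.X 1, (P.complex.d 1 0).hom.lTensor M x = 0 →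
        ∃ y : M ⊗[R] P.complex.X 2, (P.complex.d 2 1).hom.lTensor M y = s • x := by
  let G := (MonoidalCategory.tensoringLeft (ModuleCat.{u} R)).obj (ModuleCat.of R M)
  let C := (G.mapHomologicalComplex (ComplexShape.down ℕ)).obj P.complex
  let e : Tor1 R M F ≅ (C.sc' 2 1 0).homology := P.isoLeftDerivedObj G 1 ≪≫
    ShortComplex.homologyMapIso (C.isoSc' 2 1 0 (by simp) (by simp))
  rw [e.forall_smul_eq_zero_iff, ShortComplex.moduleCat_smul_homology_eq_zero_iff]
  rfl

lemma ext1_smul_eq_zero_iff_of_projectiveResolution {R : Type u} [CommRing R] (N G : Type u)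
    [AddCommGroup N] [Module R N] [AddCommGroup G] [Module R G] (s : R)
    (P : ProjectiveResolution (ModuleCat.of R N)) :
    (∀ x : Ext1 R N G, s • x = 0) ↔
      ∀ f : P.complex.X 1 →ₗ[R] G, f ∘ₗ (P.complex.d 2 1).hom = 0 →
        ∃ g : P.complex.X 0 →ₗ[R] G, g ∘ₗ (P.complex.d 1 0).hom = s • f := by
  let C := P.complex.linearYonedaObj R (ModuleCat.of R G)
  let e : Ext1 R N G ≅ (C.sc' 0 1 2).homology := P.isoExt 1 (ModuleCat.of R G) ≪≫
    ShortComplex.homologyMapIso (C.isoSc' 0 1 2 (by simp) (by simp))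
  rw [e.forall_smul_eq_zero_iff, ShortComplex.moduleCat_smul_homology_eq_zero_iff]
  constructor
  · intro h f hf
    obtain ⟨g, hg⟩ := h (ModuleCat.ofHom f) (ModuleCat.hom_ext hf)
    exact ⟨ModuleCat.Hom.hom g, congrArg ModuleCat.Hom.hom hg⟩
  · intro h f hf
    obtain ⟨g, hg⟩ := h (ModuleCat.Hom.hom f) (congrArg ModuleCat.Hom.hom hf)
    exact ⟨ModuleCat.ofHom g, ModuleCat.hom_ext hg⟩

lemma CategoryTheory.ProjectiveResolution.moduleCat_exact {R : Type u} [CommRing R]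
    {X : ModuleCat.{u} R} (P : ProjectiveResolution X) :
    Function.Exact (P.complex.d 2 1).hom (P.complex.d 1 0).hom :=
  (ShortComplex.ShortExact.moduleCat_exact_iff_function_exact _).1 (P.exact_succ 0)

lemma CategoryTheory.ProjectiveResolution.moduleCat_exact₀ {R : Type u} [CommRing R]
    {X : ModuleCat.{u} R} (P : ProjectiveResolution X) :
    Function.Exact (P.complex.d 1 0).hom (P.π.f 0).hom :=
  (ShortComplex.ShortExact.moduleCat_exact_iff_function_exact
    (ShortComplex.mk _ _ P.complex_d_comp_π_f_zero)).1
      (ShortComplex.exact_of_g_is_cokernel _ P.isColimitCokernelCofork)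

lemma tor1_smul_eq_zero_iff_s6 {R : Type u} [CommRing R] (M F : Type u)
    [AddCommGroup M] [Module R M] [AddCommGroup F] [Module R F] (s : R)
    (P : ProjectiveResolution (ModuleCat.of R F)) :
    (∀ x : Tor1 R M F, s • x = 0) ↔
      ∀ x : M ⊗[R] LinearMap.range (P.complex.d 1 0).hom,
        (LinearMap.range (P.complex.d 1 0).hom).subtype.lTensor M x = 0 → s • x = 0 := by
  rw [tor1_smul_eq_zero_iff_of_projectiveResolution M F s P]
  set d := (P.complex.d 1 0).hom
  have hs : Function.Surjective (d.rangeRestrict.lTensor M) :=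
    LinearMap.lTensor_surjective M d.surjective_rangeRestrict
  have hex : Function.Exact ((P.complex.d 2 1).hom.lTensor M) (d.rangeRestrict.lTensor M) := by
    refine lTensor_exact M (fun x => ?_) d.surjective_rangeRestrict
    rw [← P.moduleCat_exact x, Subtype.ext_iff]
    rfl
  rw [hs.forall]
  refine forall_congr' fun x => ?_
  rw [← LinearMap.comp_apply, ← LinearMap.lTensor_comp, LinearMap.subtype_comp_codRestrict,
    ← map_smul, hex]
  rfl

lemma ext1_smul_eq_zero_iff {R : Type u} [CommRing R] (N G : Type u)
    [AddCommGroup N] [Module R N] [AddCommGroup G] [Module R G] (s : R)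
    (P : ProjectiveResolution (ModuleCat.of R N)) :
    (∀ x : Ext1 R N G, s • x = 0) ↔
      ∀ f : LinearMap.range (P.complex.d 1 0).hom →ₗ[R] G, ∃ g : P.complex.X 0 →ₗ[R] G,
        g ∘ₗ (LinearMap.range (P.complex.d 1 0).hom).subtype = s • f := by
  rw [ext1_smul_eq_zero_iff_of_projectiveResolution N G s P]
  set d := (P.complex.d 1 0).hom
  have hd := P.moduleCat_exact
  constructor
  · intro h f
    obtain ⟨g, hg⟩ := h (f ∘ₗ d.rangeRestrict) (by
      ext x
      have : d.rangeRestrict ((P.complex.d 2 1).hom x) = 0 :=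
        Subtype.ext (hd.apply_apply_eq_zero x)
      simp [this])
    refine ⟨g, ?_⟩
    rw [← LinearMap.cancel_right d.surjective_rangeRestrict]
    exact hg
  · intro h f hf
    have hk : LinearMap.ker d ≤ LinearMap.ker f := by
      intro x hx
      obtain ⟨y, rfl⟩ := (hd x).1 hx
      exact LinearMap.congr_fun hf y
    let f' := (LinearMap.ker d).liftQ f hk ∘ₗ d.quotKerEquivRange.symm.toLinearMap
    have hf' (x) : f' (d.rangeRestrict x) = f x := by
      have : d.quotKerEquivRange.symm (d.rangeRestrict x) = (LinearMap.ker d).mkQ x := by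
        rw [LinearEquiv.symm_apply_eq]; rfl
      simp [f', this]
    obtain ⟨g, hg⟩ := h f'
    refine ⟨g, LinearMap.ext fun x => ?_⟩
    exact (LinearMap.congr_fun hg (d.rangeRestrict x)).trans (congrArg (s • ·) (hf' x))

/-- One half of the balancing of `Tor₁`, in terms of short exact sequences `0 → L → P → N → 0` and
`0 → K → Q → F → 0` with `P` and `Q` flat. -/
lemma smul_eq_zero_of_lTensor_eq_zero {R : Type*} [CommRing R]
    {L P N K Q F : Type*} [AddCommGroup L] [Module R L] [AddCommGroup P] [Module R P]
    [AddCommGroup N] [Module R N] [AddCommGroup K] [Module R K] [AddCommGroup Q] [Module R Q]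
    [AddCommGroup F] [Module R F] [Module.Flat R P]
    {i : L →ₗ[R] P} {p : P →ₗ[R] N} {j : K →ₗ[R] Q} {q : Q →ₗ[R] F}
    (hip : Function.Exact i p) (hp : Function.Surjective p)
    (hj : Function.Injective j) (hjq : Function.Exact j q) (hq : Function.Surjective q) {s : R}
    (h : ∀ x : L ⊗[R] F, i.rTensor F x = 0 → s • x = 0) (x : N ⊗[R] K)
    (hx : j.lTensor N x = 0) : s • x = 0 := by
  obtain ⟨y, rfl⟩ := LinearMap.rTensor_surjective K hp x
  rw [LinearMap.lTensor_rTensor_comm_apply] at hx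
  obtain ⟨z, hz⟩ := (rTensor_exact Q hip hp _).1 hx
  obtain ⟨w, hw⟩ := (lTensor_exact L hjq hq (s • z)).1 (by
    rw [map_smul]
    apply h
    rw [← LinearMap.lTensor_rTensor_comm_apply, hz]
    exact (lTensor_exact P hjq hq).apply_apply_eq_zero y)
  have : i.rTensor K w = s • y := by
    apply Module.Flat.lTensor_preserves_injective_linearMap (M := P) j hj
    rw [LinearMap.lTensor_rTensor_comm_apply, hw, map_smul, hz, map_smul]
  rw [← map_smul, ← this]
  exact (rTensor_exact K hip hp).apply_apply_eq_zero w

/-- Balancing of `Tor₁`, in terms of short exact sequences `0 → L → P → N → 0` and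
`0 → K → Q → F → 0` with `P` and `Q` flat. -/
lemma smul_lTensor_eq_zero_iff_smul_rTensor_eq_zero {R : Type*} [CommRing R]
    {L P N K Q F : Type*} [AddCommGroup L] [Module R L] [AddCommGroup P] [Module R P]
    [AddCommGroup N] [Module R N] [AddCommGroup K] [Module R K] [AddCommGroup Q] [Module R Q]
    [AddCommGroup F] [Module R F] [Module.Flat R P] [Module.Flat R Q]
    {i : L →ₗ[R] P} {p : P →ₗ[R] N} {j : K →ₗ[R] Q} {q : Q →ₗ[R] F}
    (hi : Function.Injective i) (hip : Function.Exact i p) (hp : Function.Surjective p)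
    (hj : Function.Injective j) (hjq : Function.Exact j q) (hq : Function.Surjective q) (s : R) :
    (∀ x : N ⊗[R] K, j.lTensor N x = 0 → s • x = 0) ↔
      ∀ x : L ⊗[R] F, i.rTensor F x = 0 → s • x = 0 := by
  refine ⟨fun h x hx => ?_, smul_eq_zero_of_lTensor_eq_zero hip hp hj hjq hq⟩
  apply (TensorProduct.comm R L F).injective
  rw [map_smul, map_zero]
  refine smul_eq_zero_of_lTensor_eq_zero hjq hq hi hip hp (s := s) (fun y hy => ?_) _ ?_
  · apply (TensorProduct.comm R K N).injective
    rw [map_smul, map_zero]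
    apply h
    rw [LinearMap.lTensor_comm, hy, map_zero]
  · rw [LinearMap.lTensor_comm, hx, map_zero]

lemma Module.Injective.exists_comp_eq_smul {R : Type u} [CommRing R] {A B E : Type u}
    [AddCommGroup A] [Module R A] [AddCommGroup B] [Module R B] [AddCommGroup E] [Module R E]
    (hE : Module.Injective R E) (i : A →ₗ[R] B) {s : R} (h : ∀ x, i x = 0 → s • x = 0)
    (f : A →ₗ[R] E) : ∃ g : B →ₗ[R] E, g ∘ₗ i = s • f := by
  have hk : LinearMap.ker i ≤ LinearMap.ker (s • f) := fun x hx => by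
    rw [LinearMap.mem_ker, LinearMap.smul_apply, ← map_smul, h x hx, map_zero]
  obtain ⟨g, hg⟩ := hE.out ((LinearMap.ker i).liftQ i le_rfl)
    (LinearMap.ker_eq_bot.1 (Submodule.ker_liftQ_eq_bot _ _ _ le_rfl))
    ((LinearMap.ker i).liftQ (s • f) hk)
  exact ⟨g, LinearMap.ext fun x => hg ((LinearMap.ker i).mkQ x)⟩

lemma IsInjectiveCogenerator.eq_zero_of_forall {R : Type u} [CommRing R] {A E : Type u}
    [AddCommGroup A] [Module R A] [AddCommGroup E] [Module R E]
    (hE : IsInjectiveCogenerator R E) {x : A} (h : ∀ f : A →ₗ[R] E, f x = 0) : x = 0 := by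
  have : Subsingleton (R ∙ x) := by
    refine hE.2 _ fun φ => LinearMap.ext fun y => ?_
    obtain ⟨f, hf⟩ := hE.1.out (R ∙ x).subtype (R ∙ x).subtype_injective φ
    obtain ⟨r, hr⟩ := Submodule.mem_span_singleton.1 y.2
    rw [← hf, Submodule.subtype_apply, ← hr, map_smul, h, smul_zero, LinearMap.zero_apply]
  exact congrArg Subtype.val
    (Subsingleton.elim (⟨x, Submodule.mem_span_singleton_self x⟩ : R ∙ x) 0)

lemma IsInjectiveCogenerator.smul_eq_zero {R : Type u} [CommRing R] {A B E : Type u}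
    [AddCommGroup A] [Module R A] [AddCommGroup B] [Module R B] [AddCommGroup E] [Module R E]
    (hE : IsInjectiveCogenerator R E) (i : A →ₗ[R] B) {s : R}
    (h : ∀ f : A →ₗ[R] E, ∃ g : B →ₗ[R] E, g ∘ₗ i = s • f) {x : A} (hx : i x = 0) :
    s • x = 0 := by
  refine hE.eq_zero_of_forall fun f => ?_
  obtain ⟨g, hg⟩ := h f
  rw [map_smul, ← LinearMap.smul_apply, ← hg, LinearMap.comp_apply, hx, map_zero]

lemma isInjectiveCogenerator_characterModule (R : Type u) [CommRing R] :
    IsInjectiveCogenerator R (CharacterModule R) := by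
  refine ⟨Module.Flat.iff_characterModule_injective.1 inferInstance, fun M _ _ h =>
    subsingleton_of_forall_eq 0 fun x => CharacterModule.eq_zero_of_character_apply fun c => ?_⟩
  let c' : CharacterModule (M ⊗[R] R) := CharacterModule.congr (TensorProduct.rid R M).symm c
  have : c (TensorProduct.rid R M (x ⊗ₜ 1)) = 0 :=
    congrArg (fun φ : M →ₗ[R] CharacterModule R => φ x 1) (h (CharacterModule.curry c'))
  simpa using this

/-- Extension of homomorphisms into `Hom(F, E)`, expressed via the tensor-hom adjunction. -/
lemma exists_comp_eq_smul_hom_iff {R : Type*} [CommRing R] {L P F E : Type*}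
    [AddCommGroup L] [Module R L] [AddCommGroup P] [Module R P] [AddCommGroup F] [Module R F]
    [AddCommGroup E] [Module R E] (i : L →ₗ[R] P) (s : R) :
    (∀ f : L →ₗ[R] F →ₗ[R] E, ∃ g : P →ₗ[R] F →ₗ[R] E, g ∘ₗ i = s • f) ↔
      ∀ f : L ⊗[R] F →ₗ[R] E, ∃ g : P ⊗[R] F →ₗ[R] E, g ∘ₗ i.rTensor F = s • f := by
  rw [(TensorProduct.lift.equiv (.id R) L F E).surjective.forall]
  refine forall_congr' fun f => ?_
  rw [(TensorProduct.lift.equiv (.id R) P F E).surjective.exists]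
  refine exists_congr fun g => ?_
  constructor
  · intro h
    ext x y
    simpa using LinearMap.congr_fun₂ h x y
  · intro h
    ext x y
    simpa using LinearMap.congr_fun h (x ⊗ₜ y)

lemma tor1_smul_eq_zero_iff_rTensor {R : Type u} [CommRing R] (N F : Type u)
    [AddCommGroup N] [Module R N] [AddCommGroup F] [Module R F] (s : R)
    (P : ProjectiveResolution (ModuleCat.of R N)) :
    (∀ x : Tor1 R N F, s • x = 0) ↔
      ∀ x : LinearMap.range (P.complex.d 1 0).hom ⊗[R] F,
        (LinearMap.range (P.complex.d 1 0).hom).subtype.rTensor F x = 0 → s • x = 0 := by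
  let Q := projectiveResolution (ModuleCat.of R F)
  have hflat {X : ModuleCat.{u} R} (T : ProjectiveResolution X) :
      Module.Flat R (T.complex.X 0) :=
    have : Module.Projective R (T.complex.X 0) :=
      (IsProjective.iff_projective _).2 (T.projective 0)
    inferInstance
  have hexact {X : ModuleCat.{u} R} (T : ProjectiveResolution X) :
      Function.Exact (LinearMap.range (T.complex.d 1 0).hom).subtype (T.π.f 0).hom :=
    LinearMap.exact_iff.2 <| by
      rw [Submodule.range_subtype, LinearMap.exact_iff.1 T.moduleCat_exact₀]
  have hsurj {X : ModuleCat.{u} R} (T : ProjectiveResolution X) :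
      Function.Surjective (T.π.f 0).hom :=
    (ModuleCat.epi_iff_surjective _).1 inferInstance
  have := hflat P
  have := hflat Q
  rw [tor1_smul_eq_zero_iff_s6 N F s Q]
  exact smul_lTensor_eq_zero_iff_smul_rTensor_eq_zero (Submodule.subtype_injective _) (hexact P)
    (hsurj P) (Submodule.subtype_injective _) (hexact Q) (hsurj Q) s

lemma ext1_hom_smul_eq_zero_of_tor1 {R : Type u} [CommRing R] {N F E : Type u}
    [AddCommGroup N] [Module R N] [AddCommGroup F] [Module R F] [AddCommGroup E] [Module R E]
    (hE : Module.Injective R E) {s : R} (h : ∀ x : Tor1 R N F, s • x = 0)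
    (x : Ext1 R N (F →ₗ[R] E)) : s • x = 0 := by
  let P := projectiveResolution (ModuleCat.of R N)
  refine (ext1_smul_eq_zero_iff N _ s P).2 ((exists_comp_eq_smul_hom_iff _ s).2 ?_) x
  exact hE.exists_comp_eq_smul _ ((tor1_smul_eq_zero_iff_rTensor N F s P).1 h)

lemma IsInjectiveCogenerator.tor1_smul_eq_zero_of_ext1_hom {R : Type u} [CommRing R]
    {N F E : Type u} [AddCommGroup N] [Module R N] [AddCommGroup F] [Module R F]
    [AddCommGroup E] [Module R E] (hE : IsInjectiveCogenerator R E) {s : R}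
    (h : ∀ x : Ext1 R N (F →ₗ[R] E), s • x = 0) (x : Tor1 R N F) : s • x = 0 := by
  let P := projectiveResolution (ModuleCat.of R N)
  refine (tor1_smul_eq_zero_iff_rTensor N F s P).2 (fun y hy => ?_) x
  exact hE.smul_eq_zero _
    ((exists_comp_eq_smul_hom_iff _ s).1 ((ext1_smul_eq_zero_iff N _ s P).1 h)) hy

/-- Proposition 3.4: `F` is s-flat iff `Hom_R(F, E)` is s-absolutely pure for every
injective module `E`, iff this holds for every injective cogenerator `E`. -/
theorem isSFlat_iff_hom_isSAbsolutelyPure (R : Type u) [CommRing R] (S : Submonoid R)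
    (F : Type u) [AddCommGroup F] [Module R F] :
    List.TFAE
      [ IsSFlat S F,
        ∀ (E : Type u) [AddCommGroup E] [Module R E], Module.Injective R E →
          IsSAbsolutelyPure S (F →ₗ[R] E),
        ∀ (E : Type u) [AddCommGroup E] [Module R E], IsInjectiveCogenerator R E →
          IsSAbsolutelyPure S (F →ₗ[R] E) ] := by
  tfae_have 1 → 2 := fun h E _ _ hE N _ _ hN =>
    let ⟨s, hs, hsN⟩ := h N hN
    ⟨s, hs, ext1_hom_smul_eq_zero_of_tor1 hE hsN⟩
  tfae_have 2 → 3 := fun h E _ _ hE => h E hE.1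
  tfae_have 3 → 1 := fun h N _ _ hN =>
    let hE := isInjectiveCogenerator_characterModule R
    let ⟨s, hs, hsN⟩ := h _ hE N hN
    ⟨s, hs, hE.tor1_smul_eq_zero_of_ext1_hom hsN⟩
  tfae_finish
end

section
/- Let p be a prime number, R = ℤ, S = {pⁿ | n ≥ 0}, and let J_p denote the additive group of p-adic integers ℤ_p viewed as a ℤ-module. Then: (a) J_p is s-absolutely pure, i.e., for every finitely presented ℤ-module N there exists n ≥ 0 with pⁿ·Ext¹_ℤ(N, J_p) = 0; but (b) J_p is not uniformly S-absolutely pure, i.e., there is no single n ≥ 0 such that pⁿ·Ext¹_ℤ(N, J_p) = 0 for every finitely presented ℤ-module N. -/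
open CategoryTheory TensorProduct

universe u

variable {R : Type u} [CommRing R]

/-- A scalar kills the homology of a short complex of modules iff it sends cycles to boundaries. -/
lemma CategoryTheory.ShortComplex.forall_smul_homology_eq_zero_iff
    (S : ShortComplex (ModuleCat.{u} R)) (r : R) :
    (∀ x : S.homology, r • x = 0) ↔ ∀ z : S.X₂, S.g z = 0 → ∃ y : S.X₁, S.f y = r • z := by
  let e := S.moduleCatHomologyIso.toLinearEquiv
  have h₁ : (∀ x : S.homology, r • x = 0) ↔
      ∀ x : LinearMap.ker S.g.hom ⧸ LinearMap.range S.moduleCatToCycles, r • x = 0 := by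
    constructor
    · intro h x
      apply e.symm.injective
      exact (e.symm.map_smul r x).trans ((h _).trans (map_zero e.symm).symm)
    · intro h x
      apply e.injective
      rw [map_smul, map_zero]
      exact h _
  rw [h₁]
  constructor
  · intro h z hz
    have := h (Submodule.Quotient.mk ⟨z, hz⟩)
    rw [← Submodule.Quotient.mk_smul, Submodule.Quotient.mk_eq_zero] at this
    obtain ⟨y, hy⟩ := this
    exact ⟨y, congrArg Subtype.val hy⟩
  · intro h x
    obtain ⟨⟨z, hz⟩, rfl⟩ := Submodule.Quotient.mk_surjective _ x
    rw [← Submodule.Quotient.mk_smul, Submodule.Quotient.mk_eq_zero]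
    obtain ⟨y, hy⟩ := h z hz
    exact ⟨y, Subtype.ext hy⟩

/-- A scalar kills `Ext¹` iff, for a given projective resolution, the corresponding multiple of
every 1-cocycle is a coboundary. -/
lemma forall_smul_Ext_one_eq_zero_iff {X Y : ModuleCat.{u} R} (P : ProjectiveResolution X) (r : R) :
    (∀ x : ((Ext R (ModuleCat.{u} R) 1).obj (Opposite.op X)).obj Y, r • x = 0) ↔
      ∀ f : P.complex.X 1 ⟶ Y, P.complex.d 2 1 ≫ f = 0 →
        ∃ g : P.complex.X 0 ⟶ Y, P.complex.d 1 0 ≫ g = r • f := by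
  let K := P.complex.linearYonedaObj R Y
  let e := (P.isoExt (R := R) 1 Y ≪≫
    ShortComplex.homologyMapIso (K.isoSc' 0 1 2 (by simp) (by simp))).toLinearEquiv
  refine Iff.trans ⟨fun h x => ?_, fun h x => ?_⟩
    (ShortComplex.forall_smul_homology_eq_zero_iff (K.sc' 0 1 2) r)
  · exact e.symm.injective (by rw [map_smul, map_zero]; exact h _)
  · exact e.injective (by rw [map_smul, map_zero]; exact h _)

/-- The end `P₁ → P₀ → X` of a projective resolution of modules is exact. -/
lemma CategoryTheory.ProjectiveResolution.function_exact_zero {X : ModuleCat.{u} R}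
    (P : ProjectiveResolution X) :
    Function.Exact (P.complex.d 1 0) (P.π.f 0) :=
  (ShortComplex.ShortExact.moduleCat_exact_iff_function_exact _).1 P.exact₀

/-- The segment `P₂ → P₁ → P₀` of a projective resolution of modules is exact. -/
lemma CategoryTheory.ProjectiveResolution.function_exact_one {X : ModuleCat.{u} R}
    (P : ProjectiveResolution X) :
    Function.Exact (P.complex.d 2 1) (P.complex.d 1 0) :=
  (ShortComplex.ShortExact.moduleCat_exact_iff_function_exact _).1 (P.exact_succ 0)

lemma CategoryTheory.ProjectiveResolution.surjective_π_zero {X : ModuleCat.{u} R}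
    (P : ProjectiveResolution X) :
    Function.Surjective (P.π.f 0) :=
  (ModuleCat.epi_iff_surjective _).1 inferInstance

instance CategoryTheory.ProjectiveResolution.module_projective {X : ModuleCat.{u} R}
    (P : ProjectiveResolution X) (n : ℕ) : Module.Projective R (P.complex.X n) :=
  (IsProjective.iff_projective (P.complex.X n)).2 (P.projective n)

/-- If `r` kills `Ext¹(N, E)` and `0 → L → Q → N → 0` is exact, then `r` times any map `L → E`
extends to `Q`. -/
lemma exists_extension_of_smul_Ext1_eq_zero {L Q N E : Type u} [AddCommGroup L] [Module R L]
    [AddCommGroup Q] [Module R Q] [AddCommGroup N] [Module R N] [AddCommGroup E] [Module R E]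
    {r : R} (hr : ∀ x : Ext1 R N E, r • x = 0) {i : L →ₗ[R] Q} {π : Q →ₗ[R] N}
    (hi : Function.Injective i) (hiπ : Function.Exact i π) (hπ : Function.Surjective π)
    (f : L →ₗ[R] E) : ∃ h : Q →ₗ[R] E, ∀ l, h (i l) = r • f l := by
  let P := projectiveResolution (ModuleCat.of R N)
  let ε : P.complex.X 0 →ₗ[R] N := (P.π.f 0).hom
  obtain ⟨φ₀, hφ₀⟩ := Module.projective_lifting_property π ε hπ
  replace hφ₀ (x) : π (φ₀ x) = ε x := LinearMap.congr_fun hφ₀ x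
  have hmem (y : P.complex.X 1) : φ₀ (P.complex.d 1 0 y) ∈ LinearMap.range i := by
    refine (hiπ _).1 ?_
    rw [hφ₀]
    exact P.function_exact_zero.apply_apply_eq_zero y
  obtain ⟨φ₁, hφ₁⟩ := Module.projective_lifting_property i.rangeRestrict
    ((φ₀ ∘ₗ (P.complex.d 1 0).hom).codRestrict _ hmem) i.surjective_rangeRestrict
  replace hφ₁ (y) : i (φ₁ y) = φ₀ (P.complex.d 1 0 y) :=
    congrArg Subtype.val (LinearMap.congr_fun hφ₁ y)
  obtain ⟨g, hg⟩ := (forall_smul_Ext_one_eq_zero_iff P r).1 hr (ModuleCat.ofHom (f ∘ₗ φ₁)) <| by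
    ext z
    have : φ₁ (P.complex.d 2 1 z) = 0 := hi <| by
      rw [hφ₁, P.function_exact_one.apply_apply_eq_zero, map_zero, map_zero]
    exact (congrArg f this).trans (map_zero f)
  replace hg (y) : g.hom (P.complex.d 1 0 y) = r • f (φ₁ y) :=
    LinearMap.congr_fun (congrArg ModuleCat.Hom.hom hg) y
  let σ : L × P.complex.X 0 →ₗ[R] Q := i.coprod φ₀
  let τ : L × P.complex.X 0 →ₗ[R] E := (r • f).coprod g.hom
  have hσ : Function.Surjective σ := fun x => by
    obtain ⟨y, hy⟩ := P.surjective_π_zero (π x)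
    obtain ⟨l, hl⟩ := (hiπ (x - φ₀ y)).1 (by rw [map_sub, hφ₀, sub_eq_zero]; exact hy.symm)
    exact ⟨(l, y), by simp [σ, hl]⟩
  have hστ : LinearMap.ker σ ≤ LinearMap.ker τ := by
    rintro ⟨l, x⟩ hlx
    replace hlx : i l + φ₀ x = 0 := hlx
    have hx : ε x = 0 := by
      rw [← hφ₀, eq_neg_of_add_eq_zero_right hlx, map_neg, hiπ.apply_apply_eq_zero, neg_zero]
    obtain ⟨y, rfl⟩ := (P.function_exact_zero x).1 hx
    have hl : l + φ₁ y = 0 := hi (by rw [map_add, hφ₁, hlx, map_zero])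
    change r • f l + g.hom (P.complex.d 1 0 y) = 0
    rw [hg, ← smul_add, ← map_add, hl, map_zero, smul_zero]
  obtain ⟨h, hh⟩ : ∃ h : Q →ₗ[R] E, h ∘ₗ σ = τ :=
    ⟨(LinearMap.ker σ).liftQ τ hστ ∘ₗ (σ.quotKerEquivOfSurjective hσ).symm, by
      ext x <;> simp [LinearMap.quotKerEquivOfSurjective_symm_apply]⟩
  refine ⟨h, fun l => ?_⟩
  simpa [σ, τ] using LinearMap.congr_fun hh (l, 0)

/-- Up to a nonzero scalar multiple, the identity of a finitely generated module over a principal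
ideal domain factors through a projective module. -/
lemma exists_ne_zero_smul_sub_eq_zero [IsDomain R] [IsPrincipalIdealRing R]
    (N : Type u) [AddCommGroup N] [Module R N] [Module.Finite R N] :
    ∃ m : R, m ≠ 0 ∧ ∃ (F : Type u) (_ : AddCommGroup F) (_ : Module R F)
      (_ : Module.Projective R F) (q : N →ₗ[R] F) (s : F →ₗ[R] N),
      ∀ x, m • (x - s (q x)) = 0 := by
  let T := Submodule.torsion R N
  obtain ⟨m, hm, hm₀⟩ := Submodule.annihilator_top_inter_nonZeroDivisors
    (Submodule.torsion_isTorsion (R := R) (M := N))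
  have : Module.Free R (N ⧸ T) := Module.free_of_finite_type_torsion_free'
  obtain ⟨s, hs⟩ := Module.projective_lifting_property T.mkQ LinearMap.id T.mkQ_surjective
  refine ⟨m, nonZeroDivisors.ne_zero hm₀, N ⧸ T, inferInstance, inferInstance, inferInstance,
    T.mkQ, s, fun x => ?_⟩
  have hx : x - s (T.mkQ x) ∈ T := by
    refine (Submodule.Quotient.mk_eq_zero T).1 ?_
    change T.mkQ _ = 0
    rw [map_sub, sub_eq_zero]
    exact (LinearMap.congr_fun hs _).symm
  exact congrArg Subtype.val (Submodule.mem_annihilator.1 hm ⟨_, hx⟩ Submodule.mem_top)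

/-- If `m • id` factors through a projective module on `N` and `m • v = r` on `E` for an
endomorphism `v` of `E`, then `r` kills `Ext¹(N, E)`. -/
lemma smul_Ext1_eq_zero_of_factors {N F E : Type u} [AddCommGroup N] [Module R N]
    [AddCommGroup F] [Module R F] [Module.Projective R F] [AddCommGroup E] [Module R E] {m r : R}
    {q : N →ₗ[R] F} {s : F →ₗ[R] N} (hqs : ∀ x, m • (x - s (q x)) = 0)
    {v : E →ₗ[R] E} (hv : ∀ y, m • v y = r • y) (x : Ext1 R N E) : r • x = 0 := by
  let P := projectiveResolution (ModuleCat.of R N)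
  let ε : P.complex.X 0 →ₗ[R] N := (P.π.f 0).hom
  let d : P.complex.X 1 →ₗ[R] P.complex.X 0 := (P.complex.d 1 0).hom
  obtain ⟨s', hs'⟩ := Module.projective_lifting_property ε s P.surjective_π_zero
  replace hs' (y) : ε (s' y) = s y := LinearMap.congr_fun hs' y
  have hεd (y) : ε (d y) = 0 := P.function_exact_zero.apply_apply_eq_zero y
  let t : P.complex.X 0 →ₗ[R] P.complex.X 0 := m • (LinearMap.id - s' ∘ₗ q ∘ₗ ε)
  have ht (y) : t y = m • (y - s' (q (ε y))) := rfl
  have hmem (y) : t y ∈ LinearMap.range d :=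
    (P.function_exact_zero _).1 <| by
      change ε (t y) = 0
      rw [ht, map_smul, map_sub, hs', hqs]
  obtain ⟨τ, hτ⟩ := Module.projective_lifting_property d.rangeRestrict (t.codRestrict _ hmem)
    d.surjective_rangeRestrict
  replace hτ (y) : d (τ y) = t y := congrArg Subtype.val (LinearMap.congr_fun hτ y)
  revert x
  refine (forall_smul_Ext_one_eq_zero_iff P r).2 fun f hf => ?_
  refine ⟨ModuleCat.ofHom (v ∘ₗ f.hom ∘ₗ τ), ?_⟩
  ext y
  change v (f.hom (τ (d y))) = r • f.hom y
  obtain ⟨z, hz⟩ := (P.function_exact_one (τ (d y) - m • y)).1 <| by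
    change d _ = 0
    rw [map_sub, hτ, ht, hεd, map_zero, map_zero, sub_zero, map_smul, sub_self]
  have hfz : f.hom (τ (d y) - m • y) = 0 := by
    rw [← hz]
    exact LinearMap.congr_fun (congrArg ModuleCat.Hom.hom hf) z
  rw [map_sub, map_smul, sub_eq_zero] at hfz
  rw [hfz, map_smul, hv]

/-- Example 3.9: the `p`-adic integers `J_p = ℤ_[p]` form an s-absolutely pure
`ℤ`-module (for `S = {pⁿ}`) which is not uniformly S-absolutely pure. -/
theorem padicInt_sAbsolutelyPure_not_uniformly (p : ℕ) [Fact p.Prime] :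
    (∀ (N : Type) [AddCommGroup N] [Module ℤ N], Module.FinitePresentation ℤ N →
      ∃ n : ℕ, ∀ x : Ext1 ℤ N ℤ_[p], ((p : ℤ) ^ n) • x = 0) ∧
    ¬ (∃ n : ℕ, ∀ (N : Type) [AddCommGroup N] [Module ℤ N],
        Module.FinitePresentation ℤ N → ∀ x : Ext1 ℤ N ℤ_[p], ((p : ℤ) ^ n) • x = 0) := by
  refine ⟨fun N _ _ _ => ?_, ?_⟩
  · obtain ⟨m, hm, F, _, _, _, q, s, hqs⟩ := exists_ne_zero_smul_sub_eq_zero (R := ℤ) N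
    have hm' : (m : ℤ_[p]) ≠ 0 := Int.cast_ne_zero.2 hm
    let w := PadicInt.unitCoeff hm'
    refine ⟨(m : ℤ_[p]).valuation, fun x => (int_smul_eq_zsmul _ _ x).symm.trans <|
      smul_Ext1_eq_zero_of_factors hqs (v := (AddMonoidHom.mulLeft (↑w⁻¹ : ℤ_[p])).toIntLinearMap)
        (fun y => ?_) x⟩
    change m • (↑w⁻¹ * y) = _
    rw [zsmul_eq_mul, zsmul_eq_mul]
    nth_rewrite 1 [PadicInt.unitCoeff_spec hm']
    push_cast
    rw [mul_right_comm, ← mul_assoc, Units.mul_inv, one_mul, mul_comm]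
  · rintro ⟨n, hn⟩
    let Z := ZMod (p ^ (n + 1))
    let i : ℤ →ₗ[ℤ] ℤ := LinearMap.mulLeft ℤ ((p : ℤ) ^ (n + 1))
    let π : ℤ →ₗ[ℤ] Z := (Int.castAddHom Z).toIntLinearMap
    have hp : (p : ℤ) ≠ 0 := Int.natCast_ne_zero.2 (Fact.out : p.Prime).ne_zero
    have hi : Function.Injective i := mul_right_injective₀ (pow_ne_zero _ hp)
    have hiπ : Function.Exact i π := fun x => by
      change (x : Z) = 0 ↔ _
      rw [ZMod.intCast_zmod_eq_zero_iff_dvd]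
      push_cast
      exact ⟨fun ⟨y, hy⟩ => ⟨y, hy.symm⟩, fun ⟨y, hy⟩ => ⟨y, hy.symm⟩⟩
    have : Module.Finite ℤ Z := Module.Finite.of_surjective π ZMod.intCast_surjective
    obtain ⟨h, hh⟩ := exists_extension_of_smul_Ext1_eq_zero
      (fun x => (int_smul_eq_zsmul _ _ x).trans
        (hn Z (Module.finitePresentation_of_finite ℤ Z) x)) hi hiπ ZMod.intCast_surjective
      (Int.castAddHom ℤ_[p]).toIntLinearMap
    have key : (p : ℤ_[p]) ^ (n + 1) * h 1 = p ^ n := by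
      have h₁ := hh 1
      rw [show i 1 = (p : ℤ) ^ (n + 1) • 1 from rfl, map_smul] at h₁
      simpa using h₁
    have hp' : (p : ℤ_[p]) ^ n ≠ 0 := pow_ne_zero _ PadicInt.prime_p.ne_zero
    refine PadicInt.prime_p.not_isUnit (IsUnit.of_mul_eq_one (h 1) (mul_left_cancel₀ hp' ?_))
    rw [← mul_assoc, ← pow_succ, key, mul_one]
end

section
/- Let R be a commutative ring and S a multiplicative subset of R. The following are equivalent: (1) R is an S-coherent ring; (2) any product of flat R-modules is S-flat; (3) any product of projective R-modules is S-flat; (4) any product of copies of R is S-flat. -/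
open CategoryTheory TensorProduct

universe u

variable {R : Type u} [CommRing R]

/-- The localization of `M` at `S` is flat iff every relation in `M` becomes trivial after
multiplication by an element of `S`. -/
theorem flat_localizedModule_iff {R M : Type*} [CommRing R] (S : Submonoid R)
    [AddCommGroup M] [Module R M] :
    Module.Flat (Localization S) (LocalizedModule S M) ↔
      ∀ {l : ℕ} {f : Fin l → R} {x : Fin l → M}, ∑ i, f i • x i = 0 →
        ∃ s ∈ S, Module.IsTrivialRelation f (s • x) := by
  let φ := LocalizedModule.mkLinearMap S M
  have inj_ring (s : S) {a b : Localization S} (h : (s : R) • a = (s : R) • b) : a = b :=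
    IsLocalizedModule.smul_injective (Algebra.linearMap R (Localization S)) s h
  have inj_mod (s : S) {a b : LocalizedModule S M} (h : (s : R) • a = (s : R) • b) : a = b :=
    IsLocalizedModule.smul_injective φ s h
  constructor
  · intro _ l f x h
    have h' : ∑ i, algebraMap R (Localization S) (f i) • φ (x i) = 0 := by
      simpa only [map_sum, map_smul, map_zero, algebraMap_smul] using congrArg φ h
    obtain ⟨k, A, Y, hx, hf⟩ := Module.Flat.isTrivialRelation_of_sum_smul_eq_zero h'
    obtain ⟨s, hs⟩ := IsLocalization.exist_integer_multiples_of_finite S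
      fun p : Fin l × Fin k ↦ A p.1 p.2
    choose b hb using hs
    obtain ⟨t, ht⟩ := IsLocalizedModule.exist_integer_multiples_of_finite S φ Y
    choose z hz using ht
    have hx' (i) : φ ((s * t : R) • x i) = φ (∑ j, b (i, j) • z j) := by
      rw [map_smul, show φ (x i) = _ from hx i, map_sum, Finset.smul_sum]
      refine Finset.sum_congr rfl fun j _ ↦ ?_
      rw [map_smul, hz, ← algebraMap_smul (Localization S) (b (i, j)), hb]
      exact (smul_smul_smul_comm (s : R) (A i j) (t : R) (Y j)).symm
    have hf' (j) : algebraMap R (Localization S) (∑ i, f i * b (i, j)) = 0 := by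
      have h := congrArg ((s : R) • ·) (hf j)
      simp only [Finset.smul_sum, smul_zero] at h
      rw [map_sum, ← h]
      refine Finset.sum_congr rfl fun i _ ↦ ?_
      rw [map_mul, hb]
      exact mul_smul_comm (s : R) (algebraMap R (Localization S) (f i)) (A i j)
    choose u hu using fun i ↦ (IsLocalizedModule.eq_iff_exists S φ).1 (hx' i)
    choose v hv using fun j ↦ (IsLocalization.map_eq_zero_iff S _ _).1 (hf' j)
    let U := ∏ i, u i
    let V := ∏ j, v j
    refine ⟨(U * V * (s * t) : S), Subtype.prop _, k, fun i j ↦ (U * V : S) * b (i, j), z, ?_, ?_⟩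
    · intro i
      obtain ⟨d, hd⟩ : u i ∣ U := Finset.dvd_prod_of_mem u (Finset.mem_univ i)
      have h := congrArg ((d * V : S) • ·) (hu i)
      simp only [smul_smul] at h
      rw [show d * V * u i = U * V by rw [hd, mul_right_comm, mul_comm d]] at h
      simpa only [Pi.smul_apply, Submonoid.smul_def, Submonoid.coe_mul, Finset.smul_sum,
        smul_smul] using h
    · intro j
      obtain ⟨d, hd⟩ : v j ∣ V := Finset.dvd_prod_of_mem v (Finset.mem_univ j)
      have h := congrArg ((U * d : R) * ·) (hv j)
      simp only [mul_zero] at h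
      rw [← h, hd, Finset.mul_sum, Finset.mul_sum]
      refine Finset.sum_congr rfl fun i _ ↦ ?_
      simp only [Submonoid.coe_mul]
      ring
  · intro H
    refine Module.Flat.of_forall_isTrivialRelation fun {l F X} h ↦ ?_
    obtain ⟨t, ht⟩ := IsLocalization.exist_integer_multiples_of_finite S F
    choose g hg using ht
    obtain ⟨s, hs⟩ := IsLocalizedModule.exist_integer_multiples_of_finite S φ X
    choose w hw using hs
    have h0 : φ (∑ i, g i • w i) = 0 := by
      have h := congrArg ((t * s : R) • ·) h
      simp only [Finset.smul_sum, smul_zero] at h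
      rw [map_sum, ← h]
      refine Finset.sum_congr rfl fun i _ ↦ ?_
      rw [map_smul, hw, ← algebraMap_smul (Localization S) (g i), hg]
      exact smul_smul_smul_comm _ _ _ _
    obtain ⟨u, hu⟩ := (IsLocalizedModule.eq_zero_iff S φ).1 h0
    have hu' : ∑ i, g i • (u • w i) = 0 := by
      simpa only [Finset.smul_sum, smul_comm u] using hu
    obtain ⟨s', hs', k, a, y, hy, ha⟩ := H hu'
    let c : S := ⟨s', hs'⟩ * u * s
    refine ⟨k, fun i j ↦ algebraMap R _ (a i j), fun j ↦ IsLocalizedModule.mk' φ (y j) c, ?_, ?_⟩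
    · intro i
      apply inj_mod c
      have h := congrArg φ (hy i)
      simp only [Pi.smul_apply, Submonoid.smul_def, map_smul, map_sum, hw] at h
      simp only [algebraMap_smul, Finset.smul_sum, smul_comm (c : R)]
      simp only [← Submonoid.smul_def c, IsLocalizedModule.mk'_cancel']
      simpa only [Submonoid.smul_def, c, Submonoid.coe_mul, mul_smul] using h
    · intro j
      apply inj_ring t
      rw [smul_zero, ← map_zero (algebraMap R (Localization S)), ← ha j, map_sum, Finset.smul_sum]
      refine Finset.sum_congr rfl fun i _ ↦ ?_
      rw [map_mul, hg]
      exact (smul_mul_assoc _ _ _).symm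

/-- Whether the kernel of a surjection onto `M` from a finite projective module is `S`-finite
does not depend on the surjection (a form of Schanuel's lemma). -/
theorem IsSFinitelyPresented.isSFinite_ker {R : Type u} [CommRing R] {S : Submonoid R}
    {P M : Type u} [AddCommGroup P] [Module R P] [Module.Finite R P] [Module.Projective R P]
    [AddCommGroup M] [Module R M] (h : IsSFinitelyPresented S M) (p : P →ₗ[R] M)
    (hp : Function.Surjective p) : IsSFinite S (LinearMap.ker p) := by
  obtain ⟨n, π, hπ, s, hs, K, hK, hsK⟩ := h
  obtain ⟨f, hf⟩ := Module.projective_lifting_property π p hπ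
  obtain ⟨g, hg⟩ := Module.projective_lifting_property p π hp
  replace hf (x) : π (f x) = p x := LinearMap.congr_fun hf x
  replace hg (x) : p (g x) = π x := LinearMap.congr_fun hg x
  let g' : LinearMap.ker π →ₗ[R] LinearMap.ker p :=
    g.restrict fun x hx ↦ by simpa [hg] using hx
  let e : P →ₗ[R] LinearMap.ker p :=
    (LinearMap.id - g ∘ₗ f).codRestrict _ fun x ↦ by simp [hg, hf]
  refine ⟨s, hs, LinearMap.range e ⊔ K.map g', (Submodule.fg_range e).sup (hK.map g'),
    fun x ↦ Submodule.mem_sup.2 ?_⟩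
  let y : LinearMap.ker π := ⟨f x, by simp [hf]⟩
  refine ⟨e (s • x), ⟨_, rfl⟩, g' (s • y), Submodule.mem_map_of_mem (hsK y), ?_⟩
  ext
  simp [e, g', y, ← smul_add]

/-- The kernel of the linear combination map of `f` consists of the relations satisfied by `f`. -/
theorem mem_ker_linearCombination_iff {R : Type*} [CommRing R] {n : ℕ} {f x : Fin n → R} :
    x ∈ LinearMap.ker (Fintype.linearCombination R f) ↔ ∑ i, f i * x i = 0 := by
  simp [Fintype.linearCombination_apply, mul_comm]

/-- Over an `S`-coherent ring the relations among finitely many elements form an `S`-finite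
module. -/
theorem IsSCoherentRing.isSFinite_relations {R : Type u} [CommRing R] {S : Submonoid R}
    (h : IsSCoherentRing S) {n : ℕ} (f : Fin n → R) :
    IsSFinite S (LinearMap.ker (Fintype.linearCombination R f)) := by
  have hI := h (LinearMap.range (Fintype.linearCombination R f)) (Submodule.fg_range _)
  have := hI.isSFinite_ker _ (Fintype.linearCombination R f).surjective_rangeRestrict
  rwa [LinearMap.ker_rangeRestrict] at this

/-- Over an `S`-coherent ring, products of flat modules are `S`-flat. -/
theorem IsSCoherentRing.flat_localizedModule_pi {R : Type u} [CommRing R] {S : Submonoid R}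
    (h : IsSCoherentRing S) {ι : Type*} (M : ι → Type*) [∀ i, AddCommGroup (M i)]
    [∀ i, Module R (M i)] [∀ i, Module.Flat R (M i)] :
    Module.Flat (Localization S) (LocalizedModule S (∀ i, M i)) := by
  refine (flat_localizedModule_iff S).2 fun {l f x} hfx ↦ ?_
  obtain ⟨s, hs, K, hK, hsK⟩ := h.isSFinite_relations f
  obtain ⟨m, κ, rfl⟩ := Submodule.fg_iff_exists_fin_generating_family.1 hK
  have key (i : ι) : ∃ y : Fin m → M i, ∀ j, s • x j i = ∑ q, (κ q : Fin l → R) j • y q := by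
    have hi : ∑ j, f j • x j i = 0 := by simpa using congrFun hfx i
    obtain ⟨k, a, y, hxy, ha⟩ := Module.Flat.isTrivialRelation_of_sum_smul_eq_zero hi
    choose c hc using fun p ↦ (Submodule.mem_span_range_iff_exists_fun R).1
      (hsK ⟨fun j ↦ a j p, mem_ker_linearCombination_iff.2 (ha p)⟩)
    refine ⟨fun q ↦ ∑ p, c p q • y p, fun j ↦ ?_⟩
    have hc' (p) : ∑ q, c p q * (κ q : Fin l → R) j = s * a j p := by
      simpa using congrFun (congrArg Subtype.val (hc p)) j
    simp only [hxy, Finset.smul_sum, smul_smul, ← hc', Finset.sum_smul]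
    rw [Finset.sum_comm]
    simp only [mul_comm]
  choose y hy using key
  refine ⟨s, hs, m, fun j q ↦ (κ q : Fin l → R) j, fun q i ↦ y i q, fun j ↦ ?_,
    fun q ↦ mem_ker_linearCombination_iff.1 (κ q).2⟩
  ext i
  simpa using hy i j

/-- If all powers of `R` are `S`-flat, then `R` is `S`-coherent. -/
theorem IsSCoherentRing.of_flat_localizedModule_pi {R : Type u} [CommRing R] {S : Submonoid R}
    (h : ∀ ι : Type u, Module.Flat (Localization S) (LocalizedModule S (ι → R))) :
    IsSCoherentRing S := by
  intro I hI
  obtain ⟨n, f, rfl⟩ := Submodule.fg_iff_exists_fin_generating_family.1 hI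
  rw [← Fintype.range_linearCombination R]
  refine ⟨n, _, (Fintype.linearCombination R f).surjective_rangeRestrict, ?_⟩
  rw [LinearMap.ker_rangeRestrict]
  have hrel : ∑ j, f j • (fun κ : LinearMap.ker (Fintype.linearCombination R f) ↦
      (κ : Fin n → R) j) = 0 := by
    ext κ
    simpa using mem_ker_linearCombination_iff.1 κ.2
  obtain ⟨s, hs, k, a, y, hxy, ha⟩ := (flat_localizedModule_iff S).1 (h _) hrel
  let c (p : Fin k) : LinearMap.ker (Fintype.linearCombination R f) :=
    ⟨fun j ↦ a j p, mem_ker_linearCombination_iff.2 (ha p)⟩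
  refine ⟨s, hs, Submodule.span R (Set.range c), Submodule.fg_span (Set.finite_range c),
    fun κ ↦ (Submodule.mem_span_range_iff_exists_fun R).2 ⟨fun p ↦ y p κ, ?_⟩⟩
  ext j
  simpa [c, mul_comm] using (congrFun (hxy j) κ).symm

/-- S-version of Chase's Theorem (Qi–Wang–Zhao): `R` is `S`-coherent iff products of
flat modules are `S`-flat, iff products of projective modules are `S`-flat, iff
products of copies of `R` are `S`-flat. -/
theorem isSCoherent_tfae_SFlat (R : Type u) [CommRing R] (S : Submonoid R) :
    List.TFAE
      [ IsSCoherentRing S,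
        ∀ (ι : Type u) (M : ι → Type u) [∀ i, AddCommGroup (M i)] [∀ i, Module R (M i)],
          (∀ i, Module.Flat R (M i)) →
            Module.Flat (Localization S) (LocalizedModule S (∀ i, M i)),
        ∀ (ι : Type u) (M : ι → Type u) [∀ i, AddCommGroup (M i)] [∀ i, Module R (M i)],
          (∀ i, Module.Projective R (M i)) →
            Module.Flat (Localization S) (LocalizedModule S (∀ i, M i)),
        ∀ ι : Type u, Module.Flat (Localization S) (LocalizedModule S (ι → R)) ] := by
  tfae_have 1 → 2 := fun h ι M _ _ _ ↦ h.flat_localizedModule_pi M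
  tfae_have 2 → 3 := fun h ι M _ _ _ ↦ h ι M fun _ ↦ inferInstance
  tfae_have 3 → 4 := fun h ι ↦ h ι (fun _ ↦ R) fun _ ↦ inferInstance
  tfae_have 4 → 1 := IsSCoherentRing.of_flat_localizedModule_pi
  tfae_finish
end
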